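/- arXiv:2502.01338 — 3 statements merged into one kernel-verified Lean document; each statement's English description precedes it below -/
import Mathlib

section
/- Let 𝒜 : ℂ^n → ℂ^m be bi-Lipschitz with constant α ≥ 1, let 𝒢 : ℂ^k → ℂ^n be bi-Lipschitz with constant β ≥ 1, and suppose the composition 𝒜 ∘ 𝒢 : ℂ^k → ℂ^m is bi-Lipschitz with constant γ ≥ 1. Let f₀ ∈ ℂ^n, ε ∈ ℂ^m, y = 𝒜(f₀) + ε. Let z₀ ∈ ℂ^k be a global minimizer of z ↦ ‖𝒢(z) − f₀‖₂ and let z̃ ∈ ℂ^k be a global minimizer of z ↦ ‖𝒜(𝒢(z)) − y‖₂; set f̃ = 𝒢(z̃). Then ‖f̃ − f₀‖₂ ≤ (1 + 2αβγ)‖𝒢(z₀) − f₀‖₂ + 2βγ‖ε‖₂. -/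
theorem stmt_1 {n m k : ℕ} (𝒜 : EuclideanSpace ℂ (Fin n) → EuclideanSpace ℂ (Fin m))
    (𝒢 : EuclideanSpace ℂ (Fin k) → EuclideanSpace ℂ (Fin n))
    (α β γ : ℝ) (hα : 1 ≤ α) (hβ : 1 ≤ β) (hγ : 1 ≤ γ)
    (hA : ∀ f f' : EuclideanSpace ℂ (Fin n),
      α⁻¹ * ‖f - f'‖ ≤ ‖𝒜 f - 𝒜 f'‖ ∧ ‖𝒜 f - 𝒜 f'‖ ≤ α * ‖f - f'‖)
    (hG : ∀ z z' : EuclideanSpace ℂ (Fin k),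
      β⁻¹ * ‖z - z'‖ ≤ ‖𝒢 z - 𝒢 z'‖ ∧ ‖𝒢 z - 𝒢 z'‖ ≤ β * ‖z - z'‖)
    (hAG : ∀ z z' : EuclideanSpace ℂ (Fin k),
      γ⁻¹ * ‖z - z'‖ ≤ ‖𝒜 (𝒢 z) - 𝒜 (𝒢 z')‖ ∧ ‖𝒜 (𝒢 z) - 𝒜 (𝒢 z')‖ ≤ γ * ‖z - z'‖)
    (f₀ : EuclideanSpace ℂ (Fin n)) (ε : EuclideanSpace ℂ (Fin m))
    (y : EuclideanSpace ℂ (Fin m)) (hy : y = 𝒜 f₀ + ε)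
    (z₀ : EuclideanSpace ℂ (Fin k))
    (hz₀ : ∀ z : EuclideanSpace ℂ (Fin k), ‖𝒢 z₀ - f₀‖ ≤ ‖𝒢 z - f₀‖)
    (zt : EuclideanSpace ℂ (Fin k))
    (hzt : ∀ z : EuclideanSpace ℂ (Fin k), ‖𝒜 (𝒢 zt) - y‖ ≤ ‖𝒜 (𝒢 z) - y‖)
    (ft : EuclideanSpace ℂ (Fin n)) (hft : ft = 𝒢 zt) :
    ‖ft - f₀‖ ≤ (1 + 2 * α * β * γ) * ‖𝒢 z₀ - f₀‖ + 2 * β * γ * ‖ε‖ := by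
  subst hy hft
  have hres : ‖𝒜 (𝒢 z₀) - (𝒜 f₀ + ε)‖ ≤ α * ‖𝒢 z₀ - f₀‖ + ‖ε‖ := by
    rw [← sub_sub]
    exact (norm_sub_le _ _).trans (by gcongr; exact (hA _ _).2)
  have hmeas : ‖𝒜 (𝒢 zt) - 𝒜 (𝒢 z₀)‖ ≤ 2 * (α * ‖𝒢 z₀ - f₀‖ + ‖ε‖) := by
    have h := norm_sub_le_norm_sub_add_norm_sub (𝒜 (𝒢 zt)) (𝒜 f₀ + ε) (𝒜 (𝒢 z₀))
    rw [norm_sub_rev (𝒜 f₀ + ε)] at h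
    linarith [hzt z₀]
  have hlatent : ‖zt - z₀‖ ≤ γ * ‖𝒜 (𝒢 zt) - 𝒜 (𝒢 z₀)‖ :=
    (inv_mul_le_iff₀ (by linarith)).1 (hAG zt z₀).1
  calc ‖𝒢 zt - f₀‖ ≤ ‖𝒢 zt - 𝒢 z₀‖ + ‖𝒢 z₀ - f₀‖ :=
        norm_sub_le_norm_sub_add_norm_sub _ _ _
    _ ≤ β * ‖zt - z₀‖ + ‖𝒢 z₀ - f₀‖ := by gcongr; exact (hG _ _).2
    _ ≤ β * (γ * (2 * (α * ‖𝒢 z₀ - f₀‖ + ‖ε‖))) + ‖𝒢 z₀ - f₀‖ := by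
        gcongr
        exact hlatent.trans (by gcongr)
    _ = (1 + 2 * α * β * γ) * ‖𝒢 z₀ - f₀‖ + 2 * β * γ * ‖ε‖ := by ring
end

section
/- Let 𝒜 : ℂ^n → ℂ^m be bi-Lipschitz with constant α ≥ 1, let 𝒢 : ℂ^k → ℂ^n be any map, let λ ≥ 0, f₀ ∈ ℂ^n, ε ∈ ℂ^m, and y = 𝒜(f₀) + ε. Let z₀ ∈ ℂ^k be a global minimizer of z ↦ ‖𝒢(z) − f₀‖₂, and let (f̃, z̃) ∈ ℂ^n × ℂ^k be a global minimizer of the combined objective (f, z) ↦ ‖𝒜(f) − y‖₂² + λ²‖𝒢(z) − f‖₂². Then ‖f̃ − f₀‖₂ ≤ λα‖𝒢(z₀) − f₀‖₂ + 2α‖ε‖₂. -/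
theorem stmt_2 {n m k : ℕ} (𝒜 : EuclideanSpace ℂ (Fin n) → EuclideanSpace ℂ (Fin m))
    (𝒢 : EuclideanSpace ℂ (Fin k) → EuclideanSpace ℂ (Fin n))
    (α : ℝ) (hα : 1 ≤ α)
    (hA : ∀ f f' : EuclideanSpace ℂ (Fin n),
      α⁻¹ * ‖f - f'‖ ≤ ‖𝒜 f - 𝒜 f'‖ ∧ ‖𝒜 f - 𝒜 f'‖ ≤ α * ‖f - f'‖)
    (lam : ℝ) (hlam : 0 ≤ lam)
    (f₀ : EuclideanSpace ℂ (Fin n)) (ε : EuclideanSpace ℂ (Fin m))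
    (y : EuclideanSpace ℂ (Fin m)) (hy : y = 𝒜 f₀ + ε)
    (z₀ : EuclideanSpace ℂ (Fin k))
    (hz₀ : ∀ z : EuclideanSpace ℂ (Fin k), ‖𝒢 z₀ - f₀‖ ≤ ‖𝒢 z - f₀‖)
    (ft : EuclideanSpace ℂ (Fin n)) (zt : EuclideanSpace ℂ (Fin k))
    (hmin : ∀ (f : EuclideanSpace ℂ (Fin n)) (z : EuclideanSpace ℂ (Fin k)),
      ‖𝒜 ft - y‖ ^ 2 + lam ^ 2 * ‖𝒢 zt - ft‖ ^ 2 ≤ ‖𝒜 f - y‖ ^ 2 + lam ^ 2 * ‖𝒢 z - f‖ ^ 2) :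
    ‖ft - f₀‖ ≤ lam * α * ‖𝒢 z₀ - f₀‖ + 2 * α * ‖ε‖ := by
  have hα0 : 0 < α := by linarith
  have hobj := hmin f₀ z₀
  have hy₀ : ‖𝒜 f₀ - y‖ = ‖ε‖ := by simp [hy]
  rw [hy₀] at hobj
  have hres : ‖𝒜 ft - y‖ ≤ ‖ε‖ + lam * ‖𝒢 z₀ - f₀‖ := by
    have hcross : 0 ≤ ‖ε‖ * (lam * ‖𝒢 z₀ - f₀‖) := by positivity
    have hpen : 0 ≤ lam ^ 2 * ‖𝒢 zt - ft‖ ^ 2 := by positivity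
    refine (pow_le_pow_iff_left₀ (norm_nonneg _) (by positivity) two_ne_zero).mp ?_
    linarith [mul_pow lam ‖𝒢 z₀ - f₀‖ 2, add_sq ‖ε‖ (lam * ‖𝒢 z₀ - f₀‖)]
  have htri : ‖𝒜 ft - 𝒜 f₀‖ ≤ ‖𝒜 ft - y‖ + ‖ε‖ := by
    have h := norm_sub_le_norm_sub_add_norm_sub (𝒜 ft) y (𝒜 f₀)
    rwa [norm_sub_rev y, hy₀] at h
  calc ‖ft - f₀‖ ≤ α * ‖𝒜 ft - 𝒜 f₀‖ := (inv_mul_le_iff₀ hα0).mp (hA ft f₀).1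
    _ ≤ α * (‖ε‖ + lam * ‖𝒢 z₀ - f₀‖ + ‖ε‖) := by gcongr; linarith
    _ = lam * α * ‖𝒢 z₀ - f₀‖ + 2 * α * ‖ε‖ := by ring
end

section
/- Let 𝒜 : ℂ^n → ℂ^m be bi-Lipschitz with constant α ≥ 1, let 𝒢 : ℂ^k → ℂ^n be any map, let c ≥ 0, f₀ ∈ ℂ^n, ε ∈ ℂ^m, and y = 𝒜(f₀) + ε. Set λ = c‖ε‖₂. Let z₀ ∈ ℂ^k be a global minimizer of z ↦ ‖𝒢(z) − f₀‖₂, and let (f̃, z̃) ∈ ℂ^n × ℂ^k be a global minimizer of the combined objective (f, z) ↦ ‖𝒜(f) − y‖₂² + λ²‖𝒢(z) − f‖₂². Then ‖f̃ − f₀‖₂ ≤ C‖ε‖₂ with constant C = cα‖𝒢(z₀) − f₀‖₂ + 2α depending only on α, c, and the bias ‖𝒢(z₀) − f₀‖₂. -/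
theorem stmt_10 {n m k : ℕ} (𝒜 : EuclideanSpace ℂ (Fin n) → EuclideanSpace ℂ (Fin m))
    (𝒢 : EuclideanSpace ℂ (Fin k) → EuclideanSpace ℂ (Fin n))
    (α : ℝ) (hα : 1 ≤ α)
    (hA : ∀ f f' : EuclideanSpace ℂ (Fin n),
      α⁻¹ * ‖f - f'‖ ≤ ‖𝒜 f - 𝒜 f'‖ ∧ ‖𝒜 f - 𝒜 f'‖ ≤ α * ‖f - f'‖)
    (c : ℝ) (hc : 0 ≤ c)
    (f₀ : EuclideanSpace ℂ (Fin n)) (ε : EuclideanSpace ℂ (Fin m))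
    (y : EuclideanSpace ℂ (Fin m)) (hy : y = 𝒜 f₀ + ε)
    (lam : ℝ) (hlam : lam = c * ‖ε‖)
    (z₀ : EuclideanSpace ℂ (Fin k))
    (hz₀ : ∀ z : EuclideanSpace ℂ (Fin k), ‖𝒢 z₀ - f₀‖ ≤ ‖𝒢 z - f₀‖)
    (ft : EuclideanSpace ℂ (Fin n)) (zt : EuclideanSpace ℂ (Fin k))
    (hmin : ∀ (f : EuclideanSpace ℂ (Fin n)) (z : EuclideanSpace ℂ (Fin k)),
      ‖𝒜 ft - y‖ ^ 2 + lam ^ 2 * ‖𝒢 zt - ft‖ ^ 2 ≤ ‖𝒜 f - y‖ ^ 2 + lam ^ 2 * ‖𝒢 z - f‖ ^ 2) :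
    ‖ft - f₀‖ ≤ (c * α * ‖𝒢 z₀ - f₀‖ + 2 * α) * ‖ε‖ := by
  subst hy hlam
  have hf := hmin f₀ z₀
  rw [show 𝒜 f₀ - (𝒜 f₀ + ε) = -ε by abel, norm_neg] at hf
  have hresidual : ‖𝒜 ft - (𝒜 f₀ + ε)‖ ≤ ‖ε‖ + c * ‖ε‖ * ‖𝒢 z₀ - f₀‖ := by
    refine abs_le_of_sq_le_sq' ?_ (by positivity) |>.2
    have hcross : 0 ≤ ‖ε‖ * (c * ‖ε‖ * ‖𝒢 z₀ - f₀‖) := by positivity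
    have hpenalty : 0 ≤ (c * ‖ε‖) ^ 2 * ‖𝒢 zt - ft‖ ^ 2 := by positivity
    linarith
  have htriangle : ‖𝒜 ft - 𝒜 f₀‖ ≤ ‖𝒜 ft - (𝒜 f₀ + ε)‖ + ‖ε‖ := by
    simpa [sub_add_eq_sub_sub] using norm_add_le (𝒜 ft - (𝒜 f₀ + ε)) ε
  have hlower : ‖ft - f₀‖ ≤ α * ‖𝒜 ft - 𝒜 f₀‖ :=
    (inv_mul_le_iff₀ (by linarith)).mp (hA ft f₀).1
  calc
    ‖ft - f₀‖ ≤ α * ‖𝒜 ft - 𝒜 f₀‖ := hlower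
    _ ≤ α * (‖ε‖ + c * ‖ε‖ * ‖𝒢 z₀ - f₀‖ + ‖ε‖) := by
      gcongr
      linarith
    _ = (c * α * ‖𝒢 z₀ - f₀‖ + 2 * α) * ‖ε‖ := by ring
end
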